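/- Let 0<Δ<1, let y ∈ C²(cl(B₁); ℝ³) and let 0<a<b<1. Then ∫_{B_b∖B_a} |D²y|² dL² ≥ 2πΔ² log(b/a) − 2 [ ∫_{B_b∖B_a} |g_y − g_Δ|(x)/|x|² dL²(x) + (1/(2b)) ∫_{∂B_b} |g_y − g_Δ| dH¹ + (1/(2a)) ∫_{∂B_a} |g_y − g_Δ| dH¹ ]. -/

import Mathlib

open MeasureTheory Metric Real Filter Matrix
open scoped ENNReal Topology

noncomputable section

/-- The plane `ℝ²` with the Euclidean norm. -/
abbrev E2 : Type := EuclideanSpace ℝ (Fin 2)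
/-- The space `ℝ³` with the Euclidean norm. -/
abbrev E3 : Type := EuclideanSpace ℝ (Fin 3)

/-- The `i`-th standard basis vector of `ℝ²`. -/
def e2 (i : Fin 2) : E2 := EuclideanSpace.single i 1

/-- Partial derivative in the direction of the `i`-th coordinate. -/
def pd (i : Fin 2) (f : E2 → ℝ) (x : E2) : ℝ := fderiv ℝ f x (e2 i)

/-- Hessian matrix of a scalar function on `ℝ²`. -/
def hess (f : E2 → ℝ) (x : E2) : Matrix (Fin 2) (Fin 2) ℝ :=
  Matrix.of fun i j => pd i (pd j f) x

/-- Derivative matrix `Dy ∈ ℝ^{3×2}` of a map `y : ℝ² → ℝ³`. -/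
def Dmat (y : E2 → E3) (x : E2) : Matrix (Fin 3) (Fin 2) ℝ :=
  Matrix.of fun i j => pd j (fun z => y z i) x

/-- Induced metric `g_y = (Dy)ᵀ Dy`. -/
def gmet (y : E2 → E3) (x : E2) : Matrix (Fin 2) (Fin 2) ℝ :=
  (Dmat y x)ᵀ * Dmat y x

/-- The rotated vector `x⊥ = (-x₂, x₁)`. -/
def perpVec (x : E2) : Fin 2 → ℝ := ![-(x 1), x 0]

/-- The unit tangent `x̂⊥ = (-x₂, x₁)/|x|`. -/
def xperpUnit (x : E2) : Fin 2 → ℝ := fun i => perpVec x i / ‖x‖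

/-- The reference (cone) metric `g_Δ = Id - Δ² x̂⊥ ⊗ x̂⊥`. -/
def gDelta (Δ : ℝ) (x : E2) : Matrix (Fin 2) (Fin 2) ℝ :=
  1 - Matrix.of fun i j => (Δ ^ 2 / ‖x‖ ^ 2) * perpVec x i * perpVec x j

/-- Squared Frobenius norm of a matrix. -/
def frob2 {m n : Type*} [Fintype m] [Fintype n] (A : Matrix m n ℝ) : ℝ :=
  ∑ i, ∑ j, (A i j) ^ 2

/-- `|D²y|²`: the sum of the squared Frobenius norms of the Hessians of the components. -/
def hessNormSq (y : E2 → E3) (x : E2) : ℝ :=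
  ∑ i : Fin 3, frob2 (hess (fun z => y z i) x)

/-- The free elastic energy `I_{h,Δ}(y)`. -/
def energy (h Δ : ℝ) (y : E2 → E3) : ℝ :=
  ∫ x in ball (0 : E2) 1, (frob2 (gmet y x - gDelta Δ x) + h ^ 2 * hessNormSq y x)

/-- The singular cone `y^Δ(x) = √(1-Δ²)·(x,0) + Δ|x| e₃`. -/
def coneMap (Δ : ℝ) (x : E2) : E3 :=
  (WithLp.equiv 2 (Fin 3 → ℝ)).symm
    ![Real.sqrt (1 - Δ ^ 2) * x 0, Real.sqrt (1 - Δ ^ 2) * x 1, Δ * ‖x‖]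




theorem wirtinger0 (f f' : ℝ → ℝ) (hf : ∀ x, HasDerivAt f (f' x) x) (hf' : Continuous f')
    (hper : f (-π) = f π) (hmean : ∫ x in (-π)..π, f x = 0) :
    ∫ x in (-π)..π, f x ^ 2 ≤ ∫ x in (-π)..π, f' x ^ 2 := by
  have hpi : (-π) < π := by linarith [pi_pos]
  have hfc : Continuous f := continuous_iff_continuousAt.2 fun x => (hf x).continuousAt
  set F : ℝ → ℂ := fun x => (f x : ℂ) with hF
  set F' : ℝ → ℂ := fun x => (f' x : ℂ) with hF'
  have hFc : Continuous F := Complex.continuous_ofReal.comp hfc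
  have hFc' : Continuous F' := Complex.continuous_ofReal.comp hf'
  have mem : ∀ G : ℝ → ℂ, Continuous G → MemLp G 2 (volume.restrict (Set.Ioc (-π) π)) := by
    intro G hG
    have hc : ContinuousOn G (Set.Icc (-π) π) := hG.continuousOn
    obtain ⟨C, hC⟩ := isCompact_Icc.exists_bound_of_continuousOn hc
    refine MemLp.of_bound hG.aestronglyMeasurable C ?_
    filter_upwards [ae_restrict_mem measurableSet_Ioc] with x hx
    exact hC x (Set.Ioc_subset_Icc_self hx)
  have h1 := hasSum_sq_fourierCoeffOn hpi (mem F hFc)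
  have h2 := hasSum_sq_fourierCoeffOn hpi (mem F' hFc')
  have hle : ∀ n : ℤ, ‖fourierCoeffOn hpi F n‖ ^ 2 ≤ ‖fourierCoeffOn hpi F' n‖ ^ 2 := by
    intro n
    by_cases hn : n = 0
    · subst hn
      have : fourierCoeffOn hpi F 0 = 0 := by
        rw [fourierCoeffOn_eq_integral]
        simp [hF, intervalIntegral.integral_ofReal, hmean]
      rw [this]; simp
    · have h := fourierCoeffOn_of_hasDerivAt hpi (f := F) (f' := F') hn
        (fun x _ => (hf x).ofReal_comp) (hFc'.intervalIntegrable _ _)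
      have e : F π - F (-π) = 0 := by simp [hF, hper]
      rw [e] at h
      have hpc : (π : ℂ) ≠ 0 := by exact_mod_cast pi_ne_zero
      have hnc : (n : ℂ) ≠ 0 := by exact_mod_cast hn
      have h' : fourierCoeffOn hpi F' n = Complex.I * n * fourierCoeffOn hpi F n := by
        rw [h]; push_cast; field_simp
        ring_nf
        try simp [Complex.I_sq]
      rw [h', norm_mul, norm_mul, Complex.norm_I, one_mul, mul_pow]
      have : (1:ℝ) ≤ ‖(n:ℂ)‖ ^ 2 := by
        rw [Complex.norm_intCast, sq_abs]
        have : (1:ℤ) ≤ n^2 := by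
          have := sq_pos_of_ne_zero hn
          omega
        exact_mod_cast this
      nlinarith [sq_nonneg ‖fourierCoeffOn hpi F n‖]
  have h3 := hasSum_le hle h1 h2
  simp only [hF, hF', Complex.norm_real, smul_eq_mul, Real.norm_eq_abs, sq_abs] at h3
  have hp : 0 < (π - -π)⁻¹ := by
    apply inv_pos.2; linarith
  exact le_of_mul_le_mul_left h3 hp

theorem circ_ineq (v v' w w' : ℝ → ℝ) (hv : ∀ x, HasDerivAt v (v' x) x) (hv' : Continuous v')
    (hw : ∀ x, HasDerivAt w (w' x) x) (hw' : Continuous w')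
    (pv : v (-π) = v π) (pw : w (-π) = w π) :
    ∫ x in (-π)..π, (v x * w' x - w x * v' x) ≤ ∫ x in (-π)..π, (v' x ^ 2 + w' x ^ 2) := by
  have hpi := pi_pos
  have hvc : Continuous v := continuous_iff_continuousAt.2 fun x => (hv x).continuousAt
  have hwc : Continuous w := continuous_iff_continuousAt.2 fun x => (hw x).continuousAt
  set c : ℝ := (∫ x in (-π)..π, v x) / (2 * π) with hc
  have i1 : ∀ {g : ℝ → ℝ}, Continuous g → IntervalIntegrable g volume (-π) π :=
    fun h => h.intervalIntegrable _ _
  have hW := wirtinger0 (fun x => v x - c) v' (fun x => (hv x).sub_const c) hv' (by simp [pv]) (by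
    rw [intervalIntegral.integral_sub (i1 hvc) (i1 continuous_const)]
    simp [hc]; field_simp; ring)
  have e1 : ∫ x in (-π)..π, (v' x * w x + v x * w' x) = 0 := by
    rw [intervalIntegral.integral_eq_sub_of_hasDerivAt (f := fun x => v x * w x)
      (fun x _ => (hv x).mul (hw x)) (i1 (by fun_prop))]
    simp [pv, pw]
  have e2 : ∫ x in (-π)..π, w' x = 0 := by
    rw [intervalIntegral.integral_eq_sub_of_hasDerivAt (f := w) (fun x _ => hw x) (i1 hw')]
    simp [pw]
  have e3 : ∫ x in (-π)..π, (v x * w' x - w x * v' x)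
      = ∫ x in (-π)..π, 2 * ((v x - c) * w' x) := by
    have : (fun x => v x * w' x - w x * v' x)
      = fun x => (2 * ((v x - c) * w' x) - (v' x * w x + v x * w' x)) + (2 * c) * w' x := by
      funext x; ring
    rw [this, intervalIntegral.integral_add (i1 (by fun_prop)) (i1 (by fun_prop)),
      intervalIntegral.integral_sub (i1 (by fun_prop)) (i1 (by fun_prop)),
      intervalIntegral.integral_const_mul (2 * c), e1, e2]
    ring
  rw [e3]
  calc ∫ x in (-π)..π, 2 * ((v x - c) * w' x)
      ≤ ∫ x in (-π)..π, ((v x - c) ^ 2 + w' x ^ 2) := by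
        apply intervalIntegral.integral_mono_on (by linarith) (i1 (by fun_prop)) (i1 (by fun_prop))
        intro x _
        nlinarith [sq_nonneg (v x - c - w' x)]
    _ = (∫ x in (-π)..π, (v x - c) ^ 2) + ∫ x in (-π)..π, w' x ^ 2 :=
        intervalIntegral.integral_add (i1 (by fun_prop)) (i1 (by fun_prop))
    _ ≤ (∫ x in (-π)..π, v' x ^ 2) + ∫ x in (-π)..π, w' x ^ 2 := by linarith
    _ = _ := (intervalIntegral.integral_add (i1 (by fun_prop)) (i1 (by fun_prop))).symm


/-- polar point -/
def PP (r t : ℝ) : E2 := !₂[r * Real.cos t, r * Real.sin t]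

theorem PP_zero (r t : ℝ) : PP r t 0 = r * Real.cos t := rfl
theorem PP_one (r t : ℝ) : PP r t 1 = r * Real.sin t := rfl

theorem PP_cont : Continuous fun z : ℝ × ℝ => PP z.1 z.2 := by
  unfold PP
  apply (PiLp.continuous_toLp 2 _).comp
  refine continuous_pi fun i => ?_
  fin_cases i <;> simp <;> fun_prop

theorem PP_norm {r : ℝ} (hr : 0 ≤ r) (t : ℝ) : ‖PP r t‖ = r := by
  rw [EuclideanSpace.norm_eq]
  simp only [Fin.sum_univ_two, PP_zero, PP_one, Real.norm_eq_abs, sq_abs]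
  rw [show (r * Real.cos t) ^ 2 + (r * Real.sin t) ^ 2 = r ^ 2 by
    nlinarith [Real.sin_sq_add_cos_sq t]]
  exact Real.sqrt_sq hr

theorem PP_dist {r : ℝ} (hr : 0 ≤ r) (s t : ℝ) :
    dist (PP r s) (PP r t) = r * (2 * |Real.sin ((s - t) / 2)|) := by
  rw [EuclideanSpace.dist_eq]
  simp only [Fin.sum_univ_two, PP_zero, PP_one, Real.dist_eq, sq_abs]
  rw [show (r * Real.cos s - r * Real.cos t) ^ 2 + (r * Real.sin s - r * Real.sin t) ^ 2
    = (r * (2 * |Real.sin ((s - t) / 2)|)) ^ 2 by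
      rw [mul_pow, mul_pow, sq_abs]
      have h : Real.cos (s - t) = 1 - 2 * Real.sin ((s - t)/2) ^ 2 := by
        have := Real.cos_two_mul ((s-t)/2)
        rw [show 2 * ((s-t)/2) = s - t by ring] at this
        nlinarith [Real.sin_sq_add_cos_sq ((s-t)/2)]
      rw [Real.cos_sub] at h
      have h1 := Real.sin_sq_add_cos_sq s
      have h2 := Real.sin_sq_add_cos_sq t
      linear_combination r^2 * h1 + r^2 * h2 - 2 * r^2 * h]
  exact Real.sqrt_sq (by positivity)

theorem E2_decomp (v : E2) : v = v 0 • e2 0 + v 1 • e2 1 := by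
  ext i; fin_cases i <;> simp [e2]

theorem hasDerivAt_comp_curve {f : E2 → ℝ} {c : ℝ → E2} {c0 c1 t : ℝ}
    (hf : DifferentiableAt ℝ f (c t)) (h0 : HasDerivAt (fun s => c s 0) c0 t)
    (h1 : HasDerivAt (fun s => c s 1) c1 t) :
    HasDerivAt (fun s => f (c s)) (c0 * pd 0 f (c t) + c1 * pd 1 f (c t)) t := by
  have hc : HasDerivAt c (c0 • e2 0 + c1 • e2 1) t := by
    have : c = fun s => c s 0 • e2 0 + c s 1 • e2 1 := funext fun s => E2_decomp (c s)
    rw [this]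
    exact (h0.smul_const _).add (h1.smul_const _)
  have := hf.hasFDerivAt.comp_hasDerivAt t hc
  have e : fderiv ℝ f (c t) (c0 • e2 0 + c1 • e2 1) = c0 * pd 0 f (c t) + c1 * pd 1 f (c t) := by
    simp [pd]
  rw [← e]; exact this

theorem hasDerivAt_theta {f : E2 → ℝ} (hf : Differentiable ℝ f) (r t : ℝ) :
    HasDerivAt (fun s => f (PP r s))
      (r * (-Real.sin t * pd 0 f (PP r t) + Real.cos t * pd 1 f (PP r t))) t := by
  have h0 : HasDerivAt (fun s => PP r s 0) (r * -Real.sin t) t :=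
    (Real.hasDerivAt_cos t).const_mul r
  have h1 : HasDerivAt (fun s => PP r s 1) (r * Real.cos t) t :=
    (Real.hasDerivAt_sin t).const_mul r
  have := hasDerivAt_comp_curve (hf (PP r t)) h0 h1
  convert this using 1; ring

theorem hasDerivAt_r {f : E2 → ℝ} (hf : Differentiable ℝ f) (r t : ℝ) :
    HasDerivAt (fun s => f (PP s t))
      (Real.cos t * pd 0 f (PP r t) + Real.sin t * pd 1 f (PP r t)) r := by
  have h0 : HasDerivAt (fun s => PP s t 0) (Real.cos t) r := by
    have := (hasDerivAt_id r).mul_const (Real.cos t)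
    rw [one_mul] at this; exact this
  have h1 : HasDerivAt (fun s => PP s t 1) (Real.sin t) r := by
    have := (hasDerivAt_id r).mul_const (Real.sin t)
    rw [one_mul] at this; exact this
  exact hasDerivAt_comp_curve (hf (PP r t)) h0 h1

theorem pd_contDiff {n : WithTop ℕ∞} {f : E2 → ℝ} (i : Fin 2) (hf : ContDiff ℝ (n + 1) f) :
    ContDiff ℝ n (pd i f) := by
  unfold pd
  exact (hf.fderiv_right le_rfl).clm_apply contDiff_const

theorem pd_symm {f : E2 → ℝ} (hf : ContDiff ℝ 2 f) (x : E2) (i j : Fin 2) :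
    pd i (pd j f) x = pd j (pd i f) x := by
  have hs : IsSymmSndFDerivAt ℝ f x := hf.contDiffAt.isSymmSndFDerivAt (by simp)
  have hd : DifferentiableAt ℝ (fderiv ℝ f) x :=
    ((hf.fderiv_right (m := 1) (by norm_num)).differentiable (by norm_num)) x
  have key : ∀ i j, pd i (pd j f) x = fderiv ℝ (fderiv ℝ f) x (e2 i) (e2 j) := by
    intro i j
    unfold pd
    have := (hd.hasFDerivAt.clm_apply (hasFDerivAt_const (e2 j) x)).fderiv
    rw [this]; simp
  rw [key, key]; exact hs _ _


theorem PP_sphere {r : ℝ} (hr : 0 ≤ r) (t : ℝ) : PP r t ∈ sphere (0 : E2) r := by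
  simp [PP_norm hr]

theorem PP_cont_t (r : ℝ) : Continuous (PP r) :=
  PP_cont.comp (by fun_prop : Continuous fun t : ℝ => (r, t))

theorem PP_surj {r : ℝ} (hr : 0 < r) {x : E2} (hx : ‖x‖ = r) :
    ∃ t ∈ Set.Ioc (-π) π, PP r t = x := by
  set z : ℂ := ⟨x 0, x 1⟩ with hz
  have hn : ‖z‖ = r := by
    rw [← hx, EuclideanSpace.norm_eq, Complex.norm_def, Complex.normSq_apply]
    simp [Fin.sum_univ_two, hz, sq]
  refine ⟨Complex.arg z, Complex.arg_mem_Ioc z, ?_⟩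
  ext i; fin_cases i
  · have := Complex.norm_mul_cos_arg z
    rw [hn] at this; exact this
  · have := Complex.norm_mul_sin_arg z
    rw [hn] at this; exact this

theorem PP_lip {r : ℝ} (hr : 0 ≤ r) : LipschitzWith (Real.toNNReal r) (PP r) := by
  apply LipschitzWith.of_dist_le_mul
  intro s t
  rw [PP_dist hr, Real.coe_toNNReal r hr, Real.dist_eq]
  have := Real.abs_sin_le_abs (x := (s - t) / 2)
  rw [abs_div, abs_two] at this
  apply mul_le_mul_of_nonneg_left _ hr
  linarith

theorem sphere_fin {r : ℝ} (hr : 0 < r) : μH[1] (sphere (0 : E2) r) < ⊤ := by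
  have hs : sphere (0 : E2) r ⊆ PP r '' Set.Ioc (-π) π := by
    intro x hx
    obtain ⟨t, ht, h⟩ := PP_surj hr (by simpa using hx)
    exact ⟨t, ht, h⟩
  refine lt_of_le_of_lt (measure_mono hs) (lt_of_le_of_lt
    ((PP_lip hr.le).hausdorffMeasure_image_le zero_le_one _) ?_)
  rw [hausdorffMeasure_real, Real.volume_Ioc]
  simp [ENNReal.mul_lt_top]

theorem PP_injOn {r : ℝ} (hr : 0 < r) : Set.InjOn (PP r) (Set.Ioc (-π) π) := by
  intro s hs t ht h
  have h0 : dist (PP r s) (PP r t) = 0 := by rw [h]; simp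
  rw [PP_dist hr.le] at h0
  have h1 : Real.sin ((s - t) / 2) = 0 := by
    simpa [hr.ne'] using h0
  have h2 := (Real.sin_eq_zero_iff_of_lt_of_lt (by linarith [hs.1, ht.2]) (by linarith [hs.2, ht.1])).1 h1
  linarith

/-- on short arcs -/
theorem arc_short {r : ℝ} (hr : 0 < r) {ε : ℝ} (he : 0 < ε) (he1 : ε < 1) (A : Set ℝ)
    (hA : ∀ s ∈ A, ∀ t ∈ A, |s - t| ≤ ε) :
    volume A ≤ ENNReal.ofReal (1 / (r * (1 - ε))) * μH[1] (PP r '' A) := by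
  have hpos : 0 < r * (1 - ε) := mul_pos hr (by linarith)
  have key : ∀ s ∈ A, ∀ t ∈ A, |s - t| ≤ 1 / (r * (1 - ε)) * dist (PP r s) (PP r t) := by
    intro s hs t ht
    rw [PP_dist hr.le, div_mul_eq_mul_div, le_div_iff₀ hpos, one_mul]
    have h := hA s hs t ht
    set d := |s - t| with hd
    have hd0 : 0 ≤ d := abs_nonneg _
    have hsin : |Real.sin ((s - t) / 2)| = Real.sin (d / 2) := by
      rw [Real.abs_sin_eq_sin_abs_of_abs_le_pi, abs_div, abs_two]
      rw [abs_div, abs_two]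
      have := Real.pi_gt_three
      linarith
    rw [hsin]
    have : (1 - ε) * d ≤ 2 * Real.sin (d / 2) := by
      rcases hd0.eq_or_lt with h0 | h0
      · rw [← h0]; simp
      · have := Real.sin_gt_sub_cube (x := d / 2) (by linarith)
        have h3 : d ^ 3 ≤ d * ε := by
          have : d ^ 2 ≤ ε := by nlinarith
          nlinarith
        nlinarith
    nlinarith
  set g := Function.invFunOn (PP r) A with hg
  have hinj : Set.InjOn (PP r) A := by
    intro s hs t ht h
    have := key s hs t ht
    rw [h, dist_self, mul_zero] at this
    have := abs_nonpos_iff.1 this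
    linarith
  have hgl : ∀ s ∈ A, g (PP r s) = s := fun s hs => hinj.leftInvOn_invFunOn hs
  have hL : LipschitzOnWith (Real.toNNReal (1 / (r * (1 - ε)))) g (PP r '' A) := by
    apply LipschitzOnWith.of_dist_le_mul
    rintro _ ⟨s, hs, rfl⟩ _ ⟨t, ht, rfl⟩
    rw [hgl s hs, hgl t ht, Real.dist_eq, Real.coe_toNNReal _ (by positivity)]
    exact key s hs t ht
  have := hL.hausdorffMeasure_image_le zero_le_one
  rw [hausdorffMeasure_real, ENNReal.rpow_one, Set.image_image] at this
  rw [Set.image_congr hgl, Set.image_id'] at this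
  exact this

theorem arc_long {r : ℝ} (hr : 0 < r) {ε : ℝ} (he : 0 < ε) (he1 : ε < 1) (A : Set ℝ)
    (hAm : MeasurableSet A) (hA : A ⊆ Set.Ioc (-π) π) :
    volume A ≤ ENNReal.ofReal (1 / (r * (1 - ε))) * μH[1] (PP r '' A) := by
  set J : ℤ → Set ℝ := fun n => A ∩ Set.Ioc (n • ε) ((n + 1) • ε) with hJ
  have hU : A = ⋃ n, J n := by
    rw [hJ, ← Set.inter_iUnion, iUnion_Ioc_zsmul he, Set.inter_univ]
  have hd : Pairwise (Function.onFun Disjoint J) := by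
    intro m n hmn
    exact ((Set.pairwise_disjoint_Ioc_zsmul ε) hmn).mono Set.inter_subset_right Set.inter_subset_right
  have hm : ∀ n, MeasurableSet (J n) := fun n => hAm.inter measurableSet_Ioc
  have hJA : ∀ n, J n ⊆ A := fun n => Set.inter_subset_left
  have hinj := (PP_injOn hr).mono hA
  have e1 : volume A = ∑' n, volume (J n) := by
    conv_lhs => rw [hU]
    exact measure_iUnion hd hm
  have e2 : μH[1] (PP r '' A) = ∑' n, μH[1] (PP r '' J n) := by
    conv_lhs => rw [hU, Set.image_iUnion]
    refine measure_iUnion ?_ ?_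
    · intro m n hmn
      exact Disjoint.image (hd hmn) hinj (hJA m) (hJA n)
    · intro n
      exact (hm n).image_of_continuousOn_injOn (PP_cont_t r).continuousOn (hinj.mono (hJA n))
  rw [e1, e2, ← ENNReal.tsum_mul_left]
  refine ENNReal.tsum_le_tsum fun n => arc_short hr he he1 _ ?_
  rintro s ⟨_, hs⟩ t ⟨_, ht⟩
  rw [add_smul, one_smul] at hs ht
  rw [abs_le]; constructor <;> linarith [hs.1, hs.2, ht.1, ht.2]

theorem arc_final {r : ℝ} (hr : 0 < r) (A : Set ℝ)
    (hAm : MeasurableSet A) (hA : A ⊆ Set.Ioc (-π) π) :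
    ENNReal.ofReal r * volume A ≤ μH[1] (PP r '' A) := by
  have h1 : ∀ᶠ ε in 𝓝[>] (0:ℝ), ENNReal.ofReal (r * (1 - ε)) * volume A ≤ μH[1] (PP r '' A) := by
    filter_upwards [Ioo_mem_nhdsGT (zero_lt_one)] with ε he
    have hpos : 0 < r * (1 - ε) := mul_pos hr (by linarith [he.2])
    calc _ ≤ ENNReal.ofReal (r * (1 - ε)) * (ENNReal.ofReal (1 / (r * (1 - ε))) * μH[1] (PP r '' A)) := by
          gcongr
          exact arc_long hr he.1 he.2 A hAm hA
      _ = _ := by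
          rw [← mul_assoc, ← ENNReal.ofReal_mul hpos.le, mul_one_div_cancel hpos.ne']
          simp
  have hfin : volume A ≠ ⊤ := ne_top_of_le_ne_top (by simp) (measure_mono hA)
  have h2 : Tendsto (fun ε : ℝ => ENNReal.ofReal (r * (1 - ε)) * volume A) (𝓝[>] 0)
      (𝓝 (ENNReal.ofReal r * volume A)) := by
    apply ENNReal.Tendsto.mul_const _ (Or.inr hfin)
    apply ENNReal.tendsto_ofReal
    have : Tendsto (fun ε : ℝ => r * (1 - ε)) (𝓝 0) (𝓝 (r * (1 - 0))) :=
      Continuous.tendsto (by fun_prop) _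
    rw [sub_zero, mul_one] at this
    exact this.mono_left nhdsWithin_le_nhds
  exact le_of_tendsto h2 h1

theorem sphere_integral {r : ℝ} (hr : 0 < r) (f : E2 → ℝ) (hf : ContinuousOn f (sphere 0 r))
    (hf0 : ∀ x, 0 ≤ f x) :
    r * ∫ t in Set.Ioc (-π) π, f (PP r t) ≤ ∫ x in sphere (0 : E2) r, f x ∂μH[1] := by
  set ν : Measure E2 := (ENNReal.ofReal r • volume.restrict (Set.Ioc (-π) π)).map (PP r) with hν
  have hmeas : Measurable (PP r) := (PP_cont_t r).measurable
  have hle : ν ≤ (μH[1]).restrict (sphere (0 : E2) r) := by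
    refine Measure.le_iff.2 fun S hS => ?_
    rw [hν, Measure.map_apply hmeas hS, Measure.smul_apply, Measure.restrict_apply (hmeas hS),
      Measure.restrict_apply hS, smul_eq_mul]
    refine (arc_final hr _ ((hmeas hS).inter measurableSet_Ioc) Set.inter_subset_right).trans ?_
    apply measure_mono
    rintro _ ⟨t, ⟨h1, _⟩, rfl⟩
    exact ⟨h1, PP_sphere hr.le t⟩
  have hint : IntegrableOn f (sphere (0 : E2) r) μH[1] := by
    obtain ⟨C, hC⟩ := (isCompact_sphere (0 : E2) r).exists_bound_of_continuousOn hf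
    haveI : IsFiniteMeasure ((μH[1]).restrict (sphere (0 : E2) r)) :=
      ⟨by rw [Measure.restrict_apply_univ]; exact sphere_fin hr⟩
    exact Integrable.of_bound (hf.aestronglyMeasurable isClosed_sphere.measurableSet)
      C ((ae_restrict_mem isClosed_sphere.measurableSet).mono fun x hx => hC x hx)
  have h1 := integral_mono_measure hle (ae_of_all _ hf0) hint
  refine le_trans (le_of_eq ?_) h1
  have hfm : AEStronglyMeasurable f ν := hint.aestronglyMeasurable.mono_measure hle
  rw [hν, integral_map hmeas.aemeasurable (by rw [← hν]; exact hfm), integral_smul_measure,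
    ENNReal.toReal_ofReal hr.le, smul_eq_mul]


theorem polar_integral {a b : ℝ} (ha : 0 < a) (F : E2 → ℝ) :
    ∫ x in ball (0 : E2) b \ ball 0 a, F x
      = ∫ z in Set.Ioc a b ×ˢ Set.Ioc (-π) π, z.1 * F (PP z.1 z.2) := by
  have hS : MeasurableSet (ball (0 : E2) b \ ball 0 a) := measurableSet_ball.diff measurableSet_ball
  set S := ball (0 : E2) b \ ball 0 a with hSdef
  rw [← integral_indicator hS]
  have e1 : ∫ x, S.indicator F x = ∫ p : ℝ × ℝ, S.indicator F !₂[p.1, p.2] := by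
    have h1 := (PiLp.volume_preserving_toLp (Fin 2)).comp
      (volume_preserving_finTwoArrow ℝ).symm
    have h2 : MeasurableEmbedding (WithLp.toLp 2 ∘ (MeasurableEquiv.finTwoArrow (α := ℝ)).symm) :=
      (MeasurableEquiv.toLp 2 (Fin 2 → ℝ)).measurableEmbedding.comp
        (MeasurableEquiv.finTwoArrow (α := ℝ)).symm.measurableEmbedding
    rw [← h1.integral_comp h2]
    rfl
  rw [e1, ← integral_comp_polarCoord_symm]
  have e2 : ∀ p ∈ polarCoord.target, p.1 • S.indicator F !₂[(polarCoord.symm p).1, (polarCoord.symm p).2]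
      = (Set.Ico a b ×ˢ Set.univ).indicator (fun z : ℝ × ℝ => z.1 * F (PP z.1 z.2)) p := by
    intro p hp
    have hp1 : 0 < p.1 := hp.1
    have h3 : (!₂[(polarCoord.symm p).1, (polarCoord.symm p).2] : E2) = PP p.1 p.2 := rfl
    rw [h3]
    have h4 : PP p.1 p.2 ∈ S ↔ p ∈ Set.Ico a b ×ˢ (Set.univ : Set ℝ) := by
      simp only [hSdef, Set.mem_sdiff, mem_ball_zero_iff, PP_norm hp1.le, Set.mem_prod, Set.mem_Ico,
        Set.mem_univ, and_true, not_lt]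
      tauto
    by_cases h : PP p.1 p.2 ∈ S
    · rw [Set.indicator_of_mem h, Set.indicator_of_mem (h4.1 h)]; rfl
    · rw [Set.indicator_of_notMem h, Set.indicator_of_notMem (fun h' => h (h4.2 h')), smul_zero]
  rw [setIntegral_congr_fun polarCoord.open_target.measurableSet e2,
    setIntegral_indicator (measurableSet_Ico.prod MeasurableSet.univ)]
  apply setIntegral_congr_set
  have : polarCoord.target ∩ Set.Ico a b ×ˢ Set.univ = Set.Ico a b ×ˢ Set.Ioo (-π) π := by
    ext z
    simp only [polarCoord_target, Set.mem_inter_iff, Set.mem_prod, Set.mem_Ioi, Set.mem_univ,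
      and_true, Set.mem_Ico, Set.mem_Ioo]
    constructor
    · tauto
    · rintro ⟨⟨h1, h2⟩, h3⟩
      exact ⟨⟨lt_of_lt_of_le ha h1, h3⟩, h1, h2⟩
  rw [this]
  exact Measure.set_prod_ae_eq (Ico_ae_eq_Ioc) (Ioo_ae_eq_Ioc)


/-- radial derivative -/
def pp (u : E2 → ℝ) (r t : ℝ) : ℝ :=
  Real.cos t * pd 0 u (PP r t) + Real.sin t * pd 1 u (PP r t)
/-- angular derivative -/
def qq (u : E2 → ℝ) (r t : ℝ) : ℝ :=
  -Real.sin t * pd 0 u (PP r t) + Real.cos t * pd 1 u (PP r t)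

theorem rect_int {a b : ℝ} {f : ℝ × ℝ → ℝ}
    (hf : ContinuousOn f (Set.Icc a b ×ˢ Set.Icc (-π) π)) :
    IntegrableOn f (Set.Ioc a b ×ˢ Set.Ioc (-π) π) :=
  (hf.integrableOn_compact (isCompact_Icc.prod isCompact_Icc)).mono_set
    (Set.prod_mono Set.Ioc_subset_Icc_self Set.Ioc_subset_Icc_self)

theorem PP_per (r : ℝ) : PP r (-π) = PP r π := by
  unfold PP; simp

theorem radial_ftc {Q g : ℝ → ℝ → ℝ} {a b : ℝ} (hab : a < b)
    (cQ : Continuous fun z : ℝ × ℝ => Q z.1 z.2) (cg : ∀ r, Continuous fun t => g r t)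
    (dg : ∀ r t, HasDerivAt (fun s => g s t) (Q r t) r) :
    ∫ z in Set.Ioc a b ×ˢ Set.Ioc (-π) π, Q z.1 z.2
      = (∫ t in Set.Ioc (-π) π, g b t) - ∫ t in Set.Ioc (-π) π, g a t := by
  have cQ' : Continuous fun z : ℝ × ℝ => Q z.2 z.1 :=
    cQ.comp (by fun_prop : Continuous fun z : ℝ × ℝ => (z.2, z.1))
  have sw := setIntegral_prod_swap (μ := (volume : Measure ℝ)) (ν := (volume : Measure ℝ))
    (Set.Ioc a b) (Set.Ioc (-π) π) (fun z : ℝ × ℝ => Q z.1 z.2)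
  simp only [Prod.fst_swap, Prod.snd_swap] at sw
  rw [Measure.volume_eq_prod, ← sw, setIntegral_prod]
  · have : ∀ t ∈ Set.Ioc (-π) π, ∫ r in Set.Ioc a b, Q r t = g b t - g a t := by
      intro t _
      rw [← intervalIntegral.integral_of_le hab.le]
      have c : Continuous fun r => Q r t := cQ.comp (by fun_prop : Continuous fun r : ℝ => (r, t))
      exact intervalIntegral.integral_eq_sub_of_hasDerivAt (fun r _ => dg r t)
        (c.intervalIntegrable _ _)
    rw [setIntegral_congr_fun measurableSet_Ioc this, integral_sub]
    · exact (cg b).integrableOn_Ioc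
    · exact (cg a).integrableOn_Ioc
  · exact (cQ'.continuousOn.integrableOn_compact (isCompact_Icc.prod isCompact_Icc)).mono_set
      (Set.prod_mono Set.Ioc_subset_Icc_self Set.Ioc_subset_Icc_self)

set_option maxHeartbeats 2000000 in
theorem component {u : E2 → ℝ} (hu : ContDiff ℝ 2 u) {a b : ℝ} (ha : 0 < a) (hab : a < b) :
    (∫ z in Set.Ioc a b ×ˢ Set.Ioc (-π) π, (pp u z.1 z.2 ^ 2 - qq u z.1 z.2 ^ 2) / z.1)
      - (∫ t in Set.Ioc (-π) π, qq u b t ^ 2) + (∫ t in Set.Ioc (-π) π, qq u a t ^ 2)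
    ≤ ∫ z in Set.Ioc a b ×ˢ Set.Ioc (-π) π, z.1 * frob2 (hess u (PP z.1 z.2)) := by
  have hpi : -π ≤ π := by linarith [Real.pi_pos]
  have hD : ∀ j, ContDiff ℝ 1 (pd j u) := fun j => pd_contDiff (n := 1) j (by norm_num; exact hu)
  have hDd : ∀ j, Differentiable ℝ (pd j u) := fun j => (hD j).differentiable (by norm_num)
  have hH : ∀ i j, Continuous (pd i (pd j u)) := fun i j =>
    (pd_contDiff (n := 0) i (by simpa using hD j)).continuous
  have cP := PP_cont
  have cD : ∀ j, Continuous fun z : ℝ × ℝ => pd j u (PP z.1 z.2) := fun j =>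
    (hD j).continuous.comp cP
  have cH : ∀ i j, Continuous fun z : ℝ × ℝ => pd i (pd j u) (PP z.1 z.2) := fun i j =>
    (hH i j).comp cP
  set T : Fin 2 → ℝ → ℝ → ℝ := fun j r t =>
    -Real.sin t * pd 0 (pd j u) (PP r t) + Real.cos t * pd 1 (pd j u) (PP r t) with hT
  have cT : ∀ j, Continuous fun z : ℝ × ℝ => T j z.1 z.2 := fun j =>
    ((Real.continuous_sin.comp continuous_snd).neg.mul (cH 0 j)).add
      ((Real.continuous_cos.comp continuous_snd).mul (cH 1 j))
  have dT : ∀ j r t, HasDerivAt (fun s => pd j u (PP r s)) (r * T j r t) t := fun j r t =>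
    hasDerivAt_theta (hDd j) r t
  set Φ : ℝ → ℝ → ℝ := fun r t => pd 0 u (PP r t) * T 1 r t - pd 1 u (PP r t) * T 0 r t with hΦ
  have cΦ : Continuous fun z : ℝ × ℝ => Φ z.1 z.2 :=
    ((cD 0).mul (cT 1)).sub ((cD 1).mul (cT 0))
  set Q : ℝ → ℝ → ℝ := fun r t => 2 * qq u r t *
    (-Real.sin t * (Real.cos t * pd 0 (pd 0 u) (PP r t) + Real.sin t * pd 1 (pd 0 u) (PP r t))
      + Real.cos t * (Real.cos t * pd 0 (pd 1 u) (PP r t) + Real.sin t * pd 1 (pd 1 u) (PP r t)))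
    with hQ
  have cs : Continuous fun z : ℝ × ℝ => Real.sin z.2 := Real.continuous_sin.comp continuous_snd
  have cc : Continuous fun z : ℝ × ℝ => Real.cos z.2 := Real.continuous_cos.comp continuous_snd
  have cq : Continuous fun z : ℝ × ℝ => qq u z.1 z.2 := (cs.neg.mul (cD 0)).add (cc.mul (cD 1))
  have cp : Continuous fun z : ℝ × ℝ => pp u z.1 z.2 := (cc.mul (cD 0)).add (cs.mul (cD 1))
  have cQ : Continuous fun z : ℝ × ℝ => Q z.1 z.2 :=
    (continuous_const.mul cq).mul ((cs.neg.mul ((cc.mul (cH 0 0)).add (cs.mul (cH 1 0)))).add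
      (cc.mul ((cc.mul (cH 0 1)).add (cs.mul (cH 1 1)))))
  have cF : Continuous fun z : ℝ × ℝ => z.1 * frob2 (hess u (PP z.1 z.2)) := by
    refine continuous_fst.mul ?_
    unfold frob2
    refine continuous_finsetSum _ fun i _ => continuous_finsetSum _ fun j _ => ?_
    exact (cH i j).pow 2
  have dq : ∀ r t, HasDerivAt (fun s => qq u s t ^ 2) (Q r t) r := by
    intro r t
    have h := ((hasDerivAt_r (hDd 0) r t).const_mul (-Real.sin t)).add
      ((hasDerivAt_r (hDd 1) r t).const_mul (Real.cos t))
    have h2 := h.pow 2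
    refine h2.congr_deriv ?_
    simp only [hQ, qq, Pi.add_apply]
    ring
  have csl : ∀ {f : ℝ × ℝ → ℝ} (r : ℝ), Continuous f → Continuous fun t => f (r, t) :=
    fun r hf => hf.comp (by fun_prop)
  have csl' : ∀ {f : ℝ × ℝ → ℝ} (t : ℝ), Continuous f → Continuous fun r => f (r, t) :=
    fun r hf => hf.comp (by fun_prop)
  -- slice inequality
  have S1 : ∀ r, 0 < r → ∫ t in (-π)..π, Φ r t
      ≤ ∫ t in (-π)..π, r * frob2 (hess u (PP r t)) := by
    intro r hr
    have h := circ_ineq _ _ _ _ (dT 0 r) ((csl r (cT 0)).const_mul r |> fun h => h)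
      (dT 1 r) ((csl r (cT 1)).const_mul r) (by simp only [PP_per]) (by simp only [PP_per])
    have e : ∫ t in (-π)..π, (pd 0 u (PP r t) * (r * T 1 r t) - pd 1 u (PP r t) * (r * T 0 r t))
        = r * ∫ t in (-π)..π, Φ r t := by
      rw [← intervalIntegral.integral_const_mul]
      congr 1; funext t; simp only [hΦ]; ring
    have e' : ∫ t in (-π)..π, ((r * T 0 r t) ^ 2 + (r * T 1 r t) ^ 2)
        ≤ ∫ t in (-π)..π, r * (r * frob2 (hess u (PP r t))) := by
      have k0 := csl r (cT 0)
      have k1 := csl r (cT 1)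
      have k2 := csl r cF
      apply intervalIntegral.integral_mono_on hpi
        (Continuous.intervalIntegrable (by fun_prop) _ _)
        (Continuous.intervalIntegrable (k2.const_mul r) _ _)
      intro t _
      simp only [frob2, hess, Fin.sum_univ_two, hT, Matrix.of_apply]
      set A := pd 0 (pd 0 u) (PP r t)
      set B := pd 1 (pd 0 u) (PP r t)
      set C := pd 0 (pd 1 u) (PP r t)
      set D := pd 1 (pd 1 u) (PP r t)
      have hsc := Real.sin_sq_add_cos_sq t
      have i1 : A ^ 2 + B ^ 2 - (-Real.sin t * A + Real.cos t * B) ^ 2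
          = (Real.cos t * A + Real.sin t * B) ^ 2 := by
        linear_combination (-(A ^ 2 + B ^ 2)) * hsc
      have i2 : C ^ 2 + D ^ 2 - (-Real.sin t * C + Real.cos t * D) ^ 2
          = (Real.cos t * C + Real.sin t * D) ^ 2 := by
        linear_combination (-(C ^ 2 + D ^ 2)) * hsc
      have i3 := sq_nonneg (Real.cos t * A + Real.sin t * B)
      have i4 := sq_nonneg (Real.cos t * C + Real.sin t * D)
      rw [mul_pow, mul_pow, ← mul_add, ← mul_assoc, ← sq]
      apply mul_le_mul_of_nonneg_left _ (sq_nonneg r)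
      linarith
    rw [intervalIntegral.integral_const_mul] at e'
    rw [e] at h
    exact le_of_mul_le_mul_left (h.trans e') hr
  have S2 : ∀ r, 0 < r → ∫ t in (-π)..π, Φ r t
      = ∫ t in (-π)..π, ((pp u r t ^ 2 - qq u r t ^ 2) / r - Q r t) := by
    intro r hr
    have kp := csl r cp
    have kq := csl r cq
    have kQ := csl r cQ
    have kΦ := csl r cΦ
    set W : ℝ → ℝ := fun t => r * (Φ r t - ((pp u r t ^ 2 - qq u r t ^ 2) / r - Q r t)) with hW
    have kW : Continuous W := by
      simp only [hW]; fun_prop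
    have dW : ∀ t, HasDerivAt (fun t => pp u r t * qq u r t) (W t) t := by
      intro t
      have h0 := dT 0 r t
      have h1 := dT 1 r t
      have dp := ((Real.hasDerivAt_cos t).mul h0).add ((Real.hasDerivAt_sin t).mul h1)
      have dq' := ((Real.hasDerivAt_sin t).neg.mul h0).add ((Real.hasDerivAt_cos t).mul h1)
      have := dp.mul dq'
      refine this.congr_deriv ?_
      have hs := pd_symm hu (PP r t) 0 1
      simp only [hW, hΦ, hQ, hT, pp, qq, Pi.add_apply, Pi.mul_apply, Pi.neg_apply]
      rw [hs]
      field_simp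
      have hsc := Real.sin_sq_add_cos_sq t
      have hs2 : Real.sin t ^ 2 = 1 - Real.cos t ^ 2 := by linarith
      have hs3 : Real.sin t ^ 3 = Real.sin t * (1 - Real.cos t ^ 2) := by rw [← hs2]; ring
      have hs4 : Real.sin t ^ 4 = (1 - Real.cos t ^ 2) ^ 2 := by rw [← hs2]; ring
      ring_nf
      simp only [hs2, hs3]
      ring
    have hz := intervalIntegral.integral_eq_sub_of_hasDerivAt (fun t _ => dW t)
      (kW.intervalIntegrable (-π) π)
    have hper : pp u r π * qq u r π - pp u r (-π) * qq u r (-π) = 0 := by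
      simp [pp, qq, PP_per]
    rw [hper, intervalIntegral.integral_const_mul, intervalIntegral.integral_sub
      (kΦ.intervalIntegrable _ _) (Continuous.intervalIntegrable (by fun_prop) _ _)] at hz
    have := (mul_eq_zero.1 hz).resolve_left hr.ne'
    linarith
  have cG : ContinuousOn (fun z : ℝ × ℝ => (pp u z.1 z.2 ^ 2 - qq u z.1 z.2 ^ 2) / z.1)
      (Set.Icc a b ×ˢ Set.Icc (-π) π) := by
    apply ContinuousOn.div (by fun_prop) (by fun_prop)
    rintro z ⟨hz, _⟩
    exact (lt_of_lt_of_le ha hz.1).ne'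
  have iG := rect_int cG
  have iQ : IntegrableOn (fun z : ℝ × ℝ => Q z.1 z.2) (Set.Ioc a b ×ˢ Set.Ioc (-π) π) :=
    rect_int cQ.continuousOn
  have iF : IntegrableOn (fun z : ℝ × ℝ => z.1 * frob2 (hess u (PP z.1 z.2)))
    (Set.Ioc a b ×ˢ Set.Ioc (-π) π) := rect_int cF.continuousOn
  have iGQ : IntegrableOn (fun z : ℝ × ℝ => (pp u z.1 z.2 ^ 2 - qq u z.1 z.2 ^ 2) / z.1 - Q z.1 z.2)
    (Set.Ioc a b ×ˢ Set.Ioc (-π) π) := iG.sub iQ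
  have eQ : ∫ z in Set.Ioc a b ×ˢ Set.Ioc (-π) π, Q z.1 z.2
      = (∫ t in Set.Ioc (-π) π, qq u b t ^ 2) - ∫ t in Set.Ioc (-π) π, qq u a t ^ 2 := by
    exact radial_ftc hab cQ (fun r => (csl r cq).pow 2) dq
  have main : ∫ z in Set.Ioc a b ×ˢ Set.Ioc (-π) π,
      ((pp u z.1 z.2 ^ 2 - qq u z.1 z.2 ^ 2) / z.1 - Q z.1 z.2)
      ≤ ∫ z in Set.Ioc a b ×ˢ Set.Ioc (-π) π, z.1 * frob2 (hess u (PP z.1 z.2)) := by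
    rw [Measure.volume_eq_prod] at iGQ iF ⊢
    rw [setIntegral_prod _ iGQ, setIntegral_prod _ iF]
    rw [IntegrableOn, ← Measure.prod_restrict] at iGQ iF
    refine setIntegral_mono_on iGQ.integral_prod_left iF.integral_prod_left measurableSet_Ioc ?_
    intro r hr
    have hr0 : 0 < r := ha.trans hr.1
    have := S1 r hr0
    rw [S2 r hr0, intervalIntegral.integral_of_le hpi, intervalIntegral.integral_of_le hpi] at this
    exact this
  rw [integral_sub iG iQ, eQ] at main
  linarith


theorem quad_bound {c s A B C D : ℝ} (h : s ^ 2 + c ^ 2 = 1) :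
    |c * c * A + c * s * B + s * c * C + s * s * D| ≤ √(A ^ 2 + B ^ 2 + (C ^ 2 + D ^ 2)) := by
  apply Real.abs_le_sqrt
  have h1 : (c * A + s * C) ^ 2 ≤ A ^ 2 + C ^ 2 := by
    have : A ^ 2 + C ^ 2 - (c * A + s * C) ^ 2 = (s * A - c * C) ^ 2 := by
      linear_combination (-(A ^ 2 + C ^ 2)) * h
    nlinarith [sq_nonneg (s * A - c * C)]
  have h2 : (c * B + s * D) ^ 2 ≤ B ^ 2 + D ^ 2 := by
    have : B ^ 2 + D ^ 2 - (c * B + s * D) ^ 2 = (s * B - c * D) ^ 2 := by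
      linear_combination (-(B ^ 2 + D ^ 2)) * h
    nlinarith [sq_nonneg (s * B - c * D)]
  set X := c * A + s * C
  set Y := c * B + s * D
  have h3 : c * c * A + c * s * B + s * c * C + s * s * D = c * X + s * Y := by
    simp only [X, Y]; ring
  rw [h3]
  have : X ^ 2 + Y ^ 2 - (c * X + s * Y) ^ 2 = (s * X - c * Y) ^ 2 := by
    linear_combination (-(X ^ 2 + Y ^ 2)) * h
  nlinarith [sq_nonneg (s * X - c * Y)]

/-- the deviation of the metric -/
def NN (Δ : ℝ) (y : E2 → E3) (x : E2) : ℝ := Real.sqrt (frob2 (gmet y x - gDelta Δ x))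

theorem gDelta_PP (Δ : ℝ) {r : ℝ} (hr : 0 < r) (t : ℝ) :
    gDelta Δ (PP r t) = 1 - Matrix.of fun i j =>
      Δ ^ 2 * ![-Real.sin t, Real.cos t] i * ![-Real.sin t, Real.cos t] j := by
  unfold gDelta
  rw [PP_norm hr.le]
  congr 1
  ext i j
  have hr' := hr.ne'
  fin_cases i <;> fin_cases j <;> simp [perpVec, PP_zero, PP_one] <;> field_simp

theorem pp_bound (Δ : ℝ) (y : E2 → E3) {r : ℝ} (hr : 0 < r) (t : ℝ) :
    |∑ k, pp (fun z => y z k) r t ^ 2 - 1| ≤ NN Δ y (PP r t) := by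
  have hsc := Real.sin_sq_add_cos_sq t
  have := quad_bound (A := (gmet y (PP r t) - gDelta Δ (PP r t)) 0 0)
    (B := (gmet y (PP r t) - gDelta Δ (PP r t)) 0 1)
    (C := (gmet y (PP r t) - gDelta Δ (PP r t)) 1 0)
    (D := (gmet y (PP r t) - gDelta Δ (PP r t)) 1 1) hsc
  unfold NN frob2
  simp only [Fin.sum_univ_two]
  convert this using 2
  rw [gDelta_PP Δ hr]
  simp only [gmet, Dmat, Matrix.sub_apply, Matrix.mul_apply, Matrix.transpose_apply,
    Fin.sum_univ_three, pp, Matrix.of_apply]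
  simp
  linear_combination (1 : ℝ) * hsc

theorem qq_bound (Δ : ℝ) (y : E2 → E3) {r : ℝ} (hr : 0 < r) (t : ℝ) :
    |∑ k, qq (fun z => y z k) r t ^ 2 - (1 - Δ ^ 2)| ≤ NN Δ y (PP r t) := by
  have hsc := Real.sin_sq_add_cos_sq t
  have hsc' : (Real.cos t) ^ 2 + (-Real.sin t) ^ 2 = 1 := by linarith
  have := quad_bound (A := (gmet y (PP r t) - gDelta Δ (PP r t)) 0 0)
    (B := (gmet y (PP r t) - gDelta Δ (PP r t)) 0 1)
    (C := (gmet y (PP r t) - gDelta Δ (PP r t)) 1 0)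
    (D := (gmet y (PP r t) - gDelta Δ (PP r t)) 1 1) hsc'
  unfold NN frob2
  simp only [Fin.sum_univ_two]
  convert this using 2
  rw [gDelta_PP Δ hr]
  simp only [gmet, Dmat, Matrix.sub_apply, Matrix.mul_apply, Matrix.transpose_apply,
    Fin.sum_univ_three, qq, Matrix.of_apply]
  simp
  linear_combination (1 - Δ ^ 2 * (Real.sin t ^ 2 + Real.cos t ^ 2 + 1)) * hsc

theorem y_comp {y : E2 → E3} (hy : ContDiff ℝ 2 y) (k : Fin 3) :
    ContDiff ℝ 2 (fun z => y z k) := by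
  exact (contDiff_euclidean.1 hy) k

theorem pd_cont {u : E2 → ℝ} (hu : ContDiff ℝ 2 u) (j : Fin 2) : Continuous (pd j u) :=
  (pd_contDiff (n := 1) j (by norm_num; exact hu)).continuous

theorem pd2_cont {u : E2 → ℝ} (hu : ContDiff ℝ 2 u) (i j : Fin 2) : Continuous (pd i (pd j u)) :=
  (pd_contDiff (n := 0) i (by
    simpa using pd_contDiff (n := 1) j (by norm_num; exact hu))).continuous

theorem pp_cont {u : E2 → ℝ} (hu : ContDiff ℝ 2 u) :
    Continuous fun z : ℝ × ℝ => pp u z.1 z.2 := by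
  have h0 := (pd_cont hu 0).comp PP_cont
  have h1 := (pd_cont hu 1).comp PP_cont
  exact ((Real.continuous_cos.comp continuous_snd).mul h0).add
    ((Real.continuous_sin.comp continuous_snd).mul h1)

theorem qq_cont {u : E2 → ℝ} (hu : ContDiff ℝ 2 u) :
    Continuous fun z : ℝ × ℝ => qq u z.1 z.2 := by
  have h0 := (pd_cont hu 0).comp PP_cont
  have h1 := (pd_cont hu 1).comp PP_cont
  exact ((Real.continuous_sin.comp continuous_snd).neg.mul h0).add
    ((Real.continuous_cos.comp continuous_snd).mul h1)

theorem FF_cont {u : E2 → ℝ} (hu : ContDiff ℝ 2 u) :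
    Continuous fun z : ℝ × ℝ => z.1 * frob2 (hess u (PP z.1 z.2)) := by
  refine continuous_fst.mul ?_
  unfold frob2
  refine continuous_finsetSum _ fun i _ => continuous_finsetSum _ fun j _ => ?_
  exact ((pd2_cont hu i j).comp PP_cont).pow 2

theorem NN_cont (Δ : ℝ) {y : E2 → E3} (hy : ContDiff ℝ 2 y) :
    ContinuousOn (NN Δ y) {x | x ≠ 0} := by
  unfold NN frob2
  apply ContinuousOn.sqrt
  refine continuousOn_finsetSum _ fun i _ => continuousOn_finsetSum _ fun j _ => ?_
  apply ContinuousOn.pow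
  simp only [Matrix.sub_apply]
  apply ContinuousOn.sub
  · apply Continuous.continuousOn
    simp only [gmet, Dmat, Matrix.mul_apply, Matrix.transpose_apply, Matrix.of_apply]
    exact continuous_finsetSum _ fun k _ =>
      (pd_cont (y_comp hy k) i).mul (pd_cont (y_comp hy k) j)
  · simp only [gDelta, Matrix.sub_apply, Matrix.of_apply]
    have hp : ∀ i, Continuous fun x : E2 => perpVec x i := by
      intro i
      fin_cases i <;> simp [perpVec] <;> fun_prop
    apply ContinuousOn.sub continuousOn_const
    refine ContinuousOn.mul (ContinuousOn.mul ?_ (hp i).continuousOn) (hp j).continuousOn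
    refine ContinuousOn.div continuousOn_const (by fun_prop) ?_
    intro x hx
    have : ‖x‖ ≠ 0 := norm_ne_zero_iff.2 hx
    positivity

theorem PP_ne {r : ℝ} (hr : 0 < r) (t : ℝ) : PP r t ≠ 0 := by
  intro h
  have := PP_norm hr.le t
  rw [h, norm_zero] at this
  linarith


theorem slice_cont {f : ℝ → ℝ → ℝ} (hf : Continuous fun z : ℝ × ℝ => f z.1 z.2) (r : ℝ) :
    Continuous fun t => f r t := by
  have : Continuous fun t : ℝ => (r, t) := by fun_prop
  exact hf.comp this

theorem qq_cont_t {u : E2 → ℝ} (hu : ContDiff ℝ 2 u) (r : ℝ) : Continuous fun t => qq u r t :=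
  slice_cont (f := qq u) (qq_cont hu) r


/-- lower bound for the bending energy on an annulus. -/
theorem stmt_11 (Δ : ℝ) (hΔ0 : 0 < Δ) (hΔ1 : Δ < 1) (y : E2 → E3) (hy : ContDiff ℝ 2 y)
    (a b : ℝ) (ha : 0 < a) (hab : a < b) (hb : b < 1) :
    2 * π * Δ ^ 2 * Real.log (b / a)
        - 2 * ((∫ x in ball (0 : E2) b \ ball 0 a,
              Real.sqrt (frob2 (gmet y x - gDelta Δ x)) / ‖x‖ ^ 2)
          + (1 / (2 * b)) *
              ∫ x in sphere (0 : E2) b, Real.sqrt (frob2 (gmet y x - gDelta Δ x)) ∂μH[1]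
          + (1 / (2 * a)) *
              ∫ x in sphere (0 : E2) a, Real.sqrt (frob2 (gmet y x - gDelta Δ x)) ∂μH[1])
      ≤ ∫ x in ball (0 : E2) b \ ball 0 a, hessNormSq y x := by

  have hb0 : 0 < b := ha.trans hab
  set R : Set (ℝ × ℝ) := Set.Ioc a b ×ˢ Set.Ioc (-π) π with hR
  have hRm : MeasurableSet R := measurableSet_Ioc.prod measurableSet_Ioc
  have hpi : -π ≤ π := by linarith [Real.pi_pos]
  have hN : ∀ x, Real.sqrt (frob2 (gmet y x - gDelta Δ x)) = NN Δ y x := fun _ => rfl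
  have hN0 : ∀ x, 0 ≤ NN Δ y x := fun _ => Real.sqrt_nonneg _
  simp only [hN]
  rw [polar_integral ha, polar_integral ha]
  -- spheres
  have sph : ∀ r, 0 < r → ContinuousOn (NN Δ y) (sphere 0 r) := fun r hr =>
    (NN_cont Δ hy).mono fun x hx => by
      have : ‖x‖ = r := by simpa using hx
      exact norm_ne_zero_iff.1 (by rw [this]; exact hr.ne')
  have sb := sphere_integral hb0 (NN Δ y) (sph b hb0) hN0
  have sa := sphere_integral ha (NN Δ y) (sph a ha) hN0
  have cNt : ∀ r, 0 < r → Continuous fun t => NN Δ y (PP r t) := fun r hr =>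
    continuous_iff_continuousAt.2 fun t =>
      ((NN_cont Δ hy).continuousAt (isOpen_ne.mem_nhds (PP_ne hr t))).comp
        (PP_cont_t r).continuousAt
  set U : Fin 3 → E2 → ℝ := fun k z => y z k with hU
  have hUc : ∀ k, ContDiff ℝ 2 (U k) := fun k => y_comp hy k
  have cq : ∀ k r, Continuous fun t => qq (U k) r t := fun k r =>
    qq_cont_t (hUc k) r
  have iq : ∀ k r, IntegrableOn (fun t => qq (U k) r t ^ 2) (Set.Ioc (-π) π) := fun k r =>
    ((cq k r).pow 2).integrableOn_Ioc
  have iN : ∀ r, 0 < r → IntegrableOn (fun t => NN Δ y (PP r t)) (Set.Ioc (-π) π) := fun r hr =>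
    (cNt r hr).integrableOn_Ioc
  have ic : ∀ c : ℝ, IntegrableOn (fun _ : ℝ => c) (Set.Ioc (-π) π) := fun c =>
    continuous_const.integrableOn_Ioc
  have vol : ∀ c : ℝ, ∫ _ in Set.Ioc (-π) π, c = 2 * π * c := by
    intro c
    rw [← intervalIntegral.integral_of_le hpi]
    rw [intervalIntegral.integral_const, smul_eq_mul]; ring
  have Qb : ∑ k, ∫ t in Set.Ioc (-π) π, qq (U k) b t ^ 2
      ≤ 2 * π * (1 - Δ ^ 2) + ∫ t in Set.Ioc (-π) π, NN Δ y (PP b t) := by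
    rw [← integral_finsetSum _ (fun k _ => iq k b), ← vol, ← integral_add (ic _) (iN b hb0)]
    refine setIntegral_mono (integrable_finsetSum _ (fun k _ => iq k b)) ((ic _).add (iN b hb0)) ?_
    intro t
    have := (abs_le.1 (qq_bound Δ y hb0 t)).2
    simp only [hU]
    linarith
  have Qa : 2 * π * (1 - Δ ^ 2) - ∫ t in Set.Ioc (-π) π, NN Δ y (PP a t)
      ≤ ∑ k, ∫ t in Set.Ioc (-π) π, qq (U k) a t ^ 2 := by
    rw [← integral_finsetSum _ (fun k _ => iq k a), ← vol, ← integral_sub (ic _) (iN a ha)]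
    refine setIntegral_mono ((ic _).sub (iN a ha)) (integrable_finsetSum _ (fun k _ => iq k a)) ?_
    intro t
    have := (abs_le.1 (qq_bound Δ y ha t)).1
    simp only [hU]
    linarith
  have pos : ∀ z : ℝ × ℝ, z ∈ Set.Icc a b ×ˢ Set.Icc (-π) π → 0 < z.1 := fun z hz =>
    lt_of_lt_of_le ha hz.1.1
  have iG : ∀ k, IntegrableOn (fun z : ℝ × ℝ => (pp (U k) z.1 z.2 ^ 2 - qq (U k) z.1 z.2 ^ 2) / z.1)
      R := fun k => rect_int (by
    have h1 := pp_cont (hUc k)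
    have h2 := qq_cont (hUc k)
    exact ContinuousOn.div (by fun_prop) (by fun_prop) fun z hz => (pos z hz).ne')
  have iF : ∀ k, IntegrableOn (fun z : ℝ × ℝ => z.1 * frob2 (hess (U k) (PP z.1 z.2))) R :=
    fun k => rect_int (FF_cont (hUc k)).continuousOn
  have iL : IntegrableOn (fun z : ℝ × ℝ => Δ ^ 2 * z.1⁻¹) R := rect_int (by
    exact ContinuousOn.mul continuousOn_const
      (ContinuousOn.inv₀ (by fun_prop) fun z hz => (pos z hz).ne'))
  have iNz : IntegrableOn (fun z : ℝ × ℝ => z.1 * (NN Δ y (PP z.1 z.2) / ‖PP z.1 z.2‖ ^ 2)) R :=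
    rect_int (by
      refine ContinuousOn.mul (by fun_prop) (ContinuousOn.div ?_ ?_ ?_)
      · exact (NN_cont Δ hy).comp PP_cont.continuousOn fun z hz => PP_ne (pos z hz) _
      · exact (PP_cont.norm.pow 2).continuousOn
      · intro z hz
        rw [PP_norm (pos z hz).le]
        have := pos z hz
        positivity)
  have eF : ∫ z in R, z.1 * hessNormSq y (PP z.1 z.2)
      = ∑ k, ∫ z in R, z.1 * frob2 (hess (U k) (PP z.1 z.2)) := by
    rw [← integral_finsetSum _ (fun k _ => iF k)]
    simp only [hessNormSq, Finset.mul_sum, hU]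
  have eL : ∫ z in R, Δ ^ 2 * z.1⁻¹ = 2 * π * Δ ^ 2 * Real.log (b / a) := by
    have h := setIntegral_prod_mul (μ := (volume : Measure ℝ)) (ν := (volume : Measure ℝ))
      (fun r : ℝ => r⁻¹) (fun _ : ℝ => Δ ^ 2) (Set.Ioc a b) (Set.Ioc (-π) π)
    rw [vol, ← intervalIntegral.integral_of_le hab.le, integral_inv_of_pos ha hb0] at h
    have h' : ∫ z in R, Δ ^ 2 * z.1⁻¹ = ∫ z in R, z.1⁻¹ * Δ ^ 2 := by
      congr 1; funext z; ring
    rw [h', hR, Measure.volume_eq_prod, h]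
    ring
  have G : (∫ z in R, Δ ^ 2 * z.1⁻¹)
      - 2 * (∫ z in R, z.1 * (NN Δ y (PP z.1 z.2) / ‖PP z.1 z.2‖ ^ 2))
      ≤ ∑ k, ∫ z in R, (pp (U k) z.1 z.2 ^ 2 - qq (U k) z.1 z.2 ^ 2) / z.1 := by
    rw [← integral_finsetSum _ (fun k _ => iG k), ← integral_const_mul,
      ← integral_sub iL (iNz.const_mul 2)]
    refine setIntegral_mono_on (iL.sub (iNz.const_mul 2))
      (integrable_finsetSum _ (fun k _ => iG k)) hRm ?_
    rintro ⟨r, t⟩ hz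
    have hr : 0 < r := ha.trans hz.1.1
    have h1 := (abs_le.1 (qq_bound Δ y hr t)).2
    have h2 := (abs_le.1 (pp_bound Δ y hr t)).1
    simp only
    rw [PP_norm hr.le, ← Finset.sum_div, Finset.sum_sub_distrib]
    have e : Δ ^ 2 * r⁻¹ - 2 * (r * (NN Δ y (PP r t) / r ^ 2))
        = (Δ ^ 2 - 2 * NN Δ y (PP r t)) / r := by field_simp
    rw [e]
    apply div_le_div_of_nonneg_right _ hr.le
    simp only [hU]
    linarith
  have C := Finset.sum_le_sum fun k (_ : k ∈ Finset.univ) => component (hUc k) ha hab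
  rw [← eF, Finset.sum_add_distrib, Finset.sum_sub_distrib] at C
  have fb : ∫ t in Set.Ioc (-π) π, NN Δ y (PP b t)
      ≤ 2 * ((1 / (2 * b)) * ∫ x in sphere (0 : E2) b, NN Δ y x ∂μH[1]) := by
    have : 2 * ((1 / (2 * b)) * ∫ x in sphere (0 : E2) b, NN Δ y x ∂μH[1])
      = (∫ x in sphere (0 : E2) b, NN Δ y x ∂μH[1]) / b := by field_simp
    rw [this, le_div_iff₀ hb0]; linarith
  have fa : ∫ t in Set.Ioc (-π) π, NN Δ y (PP a t)
      ≤ 2 * ((1 / (2 * a)) * ∫ x in sphere (0 : E2) a, NN Δ y x ∂μH[1]) := by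
    have : 2 * ((1 / (2 * a)) * ∫ x in sphere (0 : E2) a, NN Δ y x ∂μH[1])
      = (∫ x in sphere (0 : E2) a, NN Δ y x ∂μH[1]) / a := by field_simp
    rw [this, le_div_iff₀ ha]; linarith
  rw [eL] at G
  linarith
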